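/- Let (P_t)_{t≥0} be a Markov transition semigroup on a Polish metric space 𝒳 admitting an invariant probability measure μ*, and let z ∈ 𝒳 be such that for every bounded set A ⊆ 𝒳 and every δ > 0, inf_{x∈A} liminf_{T→∞} Q^T(x, B(z,δ)) > 0. Then μ*(B(z,δ)) > 0 for every δ > 0; that is, z belongs to the support of μ*. -/

import Mathlib

open MeasureTheory Filter Topology Metric Set

noncomputable section

/-- A Markov transition semigroup on a measurable space `X`: a jointly measurable family
of Markov probability kernels `P t x` with `P 0 x = δ_x` and the Chapman–Kolmogorov
semigroup property for nonnegative times. -/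
structure MarkovSemigroup (X : Type*) [MeasurableSpace X] where
  P : ℝ → X → MeasureTheory.Measure X
  prob : ∀ t x, MeasureTheory.IsProbabilityMeasure (P t x)
  meas : Measurable fun p : ℝ × X => P p.1 p.2
  init : ∀ x : X, P 0 x = MeasureTheory.Measure.dirac x
  semigroup : ∀ t s : ℝ, 0 ≤ t → 0 ≤ s → ∀ x : X,
    P (t + s) x = (P t x).bind (P s)

namespace MarkovSemigroup

variable {X : Type*} [MeasurableSpace X]

/-- Action `P_t f(x) = ∫ f(y) P_t(x,dy)` on functions. -/
def act (M : MarkovSemigroup X) (t : ℝ) (f : X → ℝ) (x : X) : ℝ :=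
  ∫ y, f y ∂(M.P t x)

/-- Dual action `P_t^* μ` on measures. -/
def dual (M : MarkovSemigroup X) (t : ℝ) (μ : MeasureTheory.Measure X) :
    MeasureTheory.Measure X :=
  μ.bind (M.P t)

/-- The time average `Q^T μ = (1/T) ∫_0^T P_s^* μ ds` (with the convention
`Q^T μ = μ` for `T ≤ 0`). -/
def QM (M : MarkovSemigroup X) (T : ℝ) (μ : MeasureTheory.Measure X) :
    MeasureTheory.Measure X :=
  if T ≤ 0 then μ
  else ((ENNReal.ofReal (1 / T)) • (volume.restrict (Set.Ioc (0 : ℝ) T))).bind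
    fun s => M.dual s μ

/-- `Q^T(x,·) := Q^T δ_x`. -/
def Q (M : MarkovSemigroup X) (T : ℝ) (x : X) : MeasureTheory.Measure X :=
  M.QM T (MeasureTheory.Measure.dirac x)

/-- Iterated averages: for `ts = [t_k, …, t_1]`, `QMs ts μ = Q^{t_k}(⋯(Q^{t_1} μ)⋯)`. -/
def QMs (M : MarkovSemigroup X) (ts : List ℝ) (μ : MeasureTheory.Measure X) :
    MeasureTheory.Measure X :=
  ts.foldr (fun t ν => M.QM t ν) μ

/-- A measure is invariant if `P_t^* μ = μ` for all `t ≥ 0`. -/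
def Invariant (M : MarkovSemigroup X) (μ : MeasureTheory.Measure X) : Prop :=
  ∀ t : ℝ, 0 ≤ t → M.dual t μ = μ

section TopologicalDefs

variable [TopologicalSpace X]

/-- Bounded continuous real functions. -/
def IsBddContinuous (f : X → ℝ) : Prop :=
  Continuous f ∧ ∃ C : ℝ, ∀ x, |f x| ≤ C

/-- The Feller property: `P_t` maps bounded continuous functions to continuous ones. -/
def Feller (M : MarkovSemigroup X) : Prop :=
  ∀ t : ℝ, 0 ≤ t → ∀ f : X → ℝ, MarkovSemigroup.IsBddContinuous f →
    Continuous (M.act t f)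

/-- Stochastic continuity: `P_t f(x) → f(x)` as `t → 0+`. -/
def StochasticallyContinuous (M : MarkovSemigroup X) : Prop :=
  ∀ f : X → ℝ, MarkovSemigroup.IsBddContinuous f → ∀ x : X,
    Filter.Tendsto (fun t : ℝ => M.act t f x) (nhdsWithin 0 (Set.Ioi 0)) (nhds (f x))

/-- Weak convergence of `Q^T ν` to `μ` as `T → ∞`. -/
def QTendsto (M : MarkovSemigroup X) (ν μ : MeasureTheory.Measure X) : Prop :=
  ∀ f : X → ℝ, MarkovSemigroup.IsBddContinuous f →
    Filter.Tendsto (fun T : ℝ => ∫ x, f x ∂(M.QM T ν)) Filter.atTop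
      (nhds (∫ x, f x ∂μ))

/-- Weak-* mean ergodicity with limit `μstar`. -/
def WeakStarMeanErgodic (M : MarkovSemigroup X) (μstar : MeasureTheory.Measure X) : Prop :=
  ∀ ν : MeasureTheory.Measure X, MeasureTheory.IsProbabilityMeasure ν → M.QTendsto ν μstar

/-- Tightness of the family `(Q^T(x,·))_{T>0}`. -/
def TightAt (M : MarkovSemigroup X) (x : X) : Prop :=
  ∀ ε : ℝ, 0 < ε → ∃ K : Set X, IsCompact K ∧
    ∀ T : ℝ, 0 < T → 1 - ε ≤ ((M.Q T x) K).toReal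

end TopologicalDefs

end MarkovSemigroup

/-- Topological support of a measure: points all of whose open neighborhoods
have positive mass. -/
def msupport {X : Type*} [MeasurableSpace X] [TopologicalSpace X]
    (μ : MeasureTheory.Measure X) : Set X :=
  {x : X | ∀ U : Set X, IsOpen U → x ∈ U → 0 < μ U}

/-- Total variation distance between two (finite) measures, as the supremum over
Borel sets of the discrepancy of masses. -/
def tvDist {X : Type*} [MeasurableSpace X] (μ ν : MeasureTheory.Measure X) : ℝ :=
  ⨆ B : {B : Set X // MeasurableSet B}, |(μ B.1).toReal - (ν B.1).toReal|

section MetricDefs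

variable {X : Type*} [MeasurableSpace X] [PseudoMetricSpace X]

/-- Bounded Lipschitz real functions. -/
def IsBddLipschitz (ψ : X → ℝ) : Prop :=
  (∃ K : NNReal, LipschitzWith K ψ) ∧ ∃ C : ℝ, ∀ x, |ψ x| ≤ C

/-- The e-property: equicontinuity of `(P_t ψ)_{t ≥ 0}` at every point, for every
bounded Lipschitz `ψ`. -/
def MarkovSemigroup.EProperty (M : MarkovSemigroup X) : Prop :=
  ∀ ψ : X → ℝ, IsBddLipschitz ψ → ∀ x : X, ∀ ε : ℝ, 0 < ε →
    ∃ δ : ℝ, 0 < δ ∧ ∀ z : X, dist z x < δ → ∀ t : ℝ, 0 ≤ t →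
      |M.act t ψ z - M.act t ψ x| < ε

end MetricDefs

namespace MarkovSemigroup

variable {X : Type*} [MeasurableSpace X]

lemma measurable_P (M : MarkovSemigroup X) (t : ℝ) : Measurable (M.P t) :=
  M.meas.comp (measurable_const.prodMk measurable_id)

lemma measurable_P_left (M : MarkovSemigroup X) (x : X) : Measurable fun t => M.P t x :=
  M.meas.comp (measurable_id.prodMk measurable_const)

lemma Q_apply (M : MarkovSemigroup X) {T : ℝ} (hT : 0 < T) (x : X) {B : Set X}
    (hB : MeasurableSet B) :
    M.Q T x B = ENNReal.ofReal (1 / T) * ∫⁻ s in Set.Ioc 0 T, M.P s x B := by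
  have hdual : (fun s => M.dual s (Measure.dirac x)) = fun s => M.P s x :=
    funext fun s => Measure.dirac_bind (M.measurable_P s) x
  rw [Q, QM, if_neg hT.not_ge, hdual,
    Measure.bind_apply hB (M.measurable_P_left x).aemeasurable, lintegral_smul_measure,
    smul_eq_mul]

/-- A null set of an invariant measure is almost surely never charged by the time averages. -/
lemma Invariant.ae_Q_eq_zero {M : MarkovSemigroup X} {μ : Measure X} [SFinite μ]
    (hμ : M.Invariant μ) {B : Set X} (hB : MeasurableSet B) (h0 : μ B = 0) :
    ∀ᵐ x ∂μ, ∀ T : ℝ, 0 < T → M.Q T x B = 0 := by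
  have hmeas : Measurable fun p : X × ℝ => M.P p.2 p.1 B :=
    (Measure.measurable_coe hB).comp (M.meas.comp measurable_swap)
  have hzero : ∫⁻ x, (∫⁻ s in Set.Ioi 0, M.P s x B) ∂μ = 0 := by
    rw [lintegral_lintegral_swap hmeas.aemeasurable]
    refine (setLIntegral_congr_fun measurableSet_Ioi fun s hs => ?_).trans lintegral_zero
    have h := congrArg (fun ν : Measure X => ν B) (hμ s (le_of_lt hs))
    simp only [dual, h0] at h
    rwa [Measure.bind_apply hB (M.measurable_P s).aemeasurable] at h
  have hae := (lintegral_eq_zero_iff hmeas.lintegral_prod_right').1 hzero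
  filter_upwards [hae] with x hx T hT
  have hle : ∫⁻ s in Set.Ioc 0 T, M.P s x B ≤ ∫⁻ s in Set.Ioi 0, M.P s x B :=
    lintegral_mono_set Set.Ioc_subset_Ioi_self
  have hz : ∫⁻ s in Set.Ioc 0 T, M.P s x B = 0 := le_antisymm (hle.trans hx.le) zero_le
  rw [M.Q_apply hT x hB, hz, mul_zero]

end MarkovSemigroup

/-- beginning of the proof of Theorem 2. If a Markov semigroup has an
invariant probability measure `μ*` and the ergodic averages of all balls `B(z,δ)` have a
lower bound which is uniform over bounded sets, then every ball around `z` has positive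
`μ*`-measure, i.e. `z ∈ supp μ*`. -/
theorem point_in_support_of_invariant_measure
    {X : Type*} [MetricSpace X] [CompleteSpace X] [SecondCountableTopology X]
    [MeasurableSpace X] [BorelSpace X]
    (M : MarkovSemigroup X)
    (μstar : MeasureTheory.Measure X)
    (hprob : MeasureTheory.IsProbabilityMeasure μstar)
    (hinv : M.Invariant μstar)
    (z : X)
    (hlow : ∀ A : Set X, Bornology.IsBounded A → ∀ δ : ℝ, 0 < δ →
      ∃ c : ℝ, 0 < c ∧ ∀ x ∈ A,
        c ≤ Filter.liminf (fun T : ℝ => ((M.Q T x) (Metric.ball z δ)).toReal)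
          Filter.atTop) :
    ∀ δ : ℝ, 0 < δ → 0 < μstar (Metric.ball z δ) := by
  intro δ hδ
  refine pos_iff_ne_zero.2 fun h0 => ?_
  obtain ⟨x, hx⟩ := (hinv.ae_Q_eq_zero measurableSet_ball h0).exists
  obtain ⟨c, hc, hle⟩ := hlow {x} Bornology.isBounded_singleton δ hδ
  have hev : (fun T : ℝ => (M.Q T x (Metric.ball z δ)).toReal) =ᶠ[atTop] fun _ => (0 : ℝ) := by
    filter_upwards [eventually_gt_atTop 0] with T hT
    rw [hx T hT, ENNReal.toReal_zero]
  have h := hle x rfl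
  rw [liminf_congr hev, liminf_const] at h
  exact absurd h hc.not_ge
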